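/- Let B > 0, β > 0, and d ≥ 1. For g ∈ ℝ and s ∈ {−1, 1} write q(g, s) = (B + β + s·clip(g, B))/(2B + 2β). Then for all g, g′ ∈ ℝ^d with ‖g − g′‖₁ ≤ 1 and all s ∈ {−1, 1}^d, ∏_{i=1}^d q(g′_i, s_i) ≤ (∏_{i=1}^d (1 + 1/(β + max(B − |g_i|, 0)))) · ∏_{i=1}^d q(g_i, s_i). That is, the coordinate-wise independent compressor M_{B,β} is Σ_{i=1}^d log(1 + 1/(β + dist(g_i, C_B)))-differentially private at g, where dist(g_i, C_B) = max(B − |g_i|, 0) is the distance from g_i to C_B = (−∞, −B) ∪ (B, ∞). -/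

import Mathlib

open scoped BigOperators

/-- Clipping to `[-B, B]` is 1-Lipschitz. -/
theorem abs_clip_sub_clip_le (B x y : ℝ) :
    |max (-B) (min B x) - max (-B) (min B y)| ≤ |x - y| :=
  calc |max (-B) (min B x) - max (-B) (min B y)|
      ≤ max |(-B) - (-B)| |min B x - min B y| := abs_max_sub_max_le_max _ _ _ _
    _ = |min B x - min B y| := by simp
    _ ≤ max |B - B| |x - y| := abs_min_sub_min_le_max _ _ _ _
    _ = |x - y| := by simp

/-- The distance to the clipping region is at most the distance of the clipped value to `±B`. -/
theorem max_sub_abs_le_sub_abs_clip {B : ℝ} (hB : 0 < B) (x : ℝ) :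
    max (B - |x|) 0 ≤ B - |max (-B) (min B x)| := by
  have h₁ : |max (-B) (min B x)| ≤ B :=
    abs_le.2 ⟨le_max_left _ _, max_le (by linarith) (min_le_left _ _)⟩
  have h₂ : |max (-B) (min B x)| ≤ |x| := by
    have h := abs_clip_sub_clip_le B x 0
    rwa [min_eq_right hB.le, max_eq_right (by linarith : -B ≤ 0), sub_zero, sub_zero] at h
  exact max_le (by linarith) (by linarith)

/-- `β + dist(x, C_B)` is a lower bound for the unnormalised probability of either sign. -/
theorem add_max_sub_abs_le_compressor {B : ℝ} (hB : 0 < B) (β x : ℝ) {s : ℝ}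
    (hs : s = -1 ∨ s = 1) :
    β + max (B - |x|) 0 ≤ B + β + s * max (-B) (min B x) := by
  have h := max_sub_abs_le_sub_abs_clip hB x
  have h₁ := neg_abs_le (max (-B) (min B x))
  have h₂ := le_abs_self (max (-B) (min B x))
  rcases hs with rfl | rfl <;> linarith

/-- The privacy bound for a single coordinate. -/
theorem compressor_dp_fine {B β : ℝ} (hB : 0 < B) (hβ : 0 < β) {x y s : ℝ}
    (hxy : |x - y| ≤ 1) (hs : s = -1 ∨ s = 1) :
    (B + β + s * max (-B) (min B y)) / (2 * B + 2 * β) ≤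
      (1 + 1 / (β + max (B - |x|) 0)) *
        ((B + β + s * max (-B) (min B x)) / (2 * B + 2 * β)) := by
  have hlow := add_max_sub_abs_le_compressor hB β x hs
  have hpos : 0 < β + max (B - |x|) 0 := add_pos_of_pos_of_nonneg hβ (le_max_right _ _)
  have hclip := abs_le.1 ((abs_clip_sub_clip_le B x y).trans hxy)
  have hstep : B + β + s * max (-B) (min B y) ≤ B + β + s * max (-B) (min B x) + 1 := by
    rcases hs with rfl | rfl <;> linarith [hclip.1, hclip.2]
  rw [← mul_div_assoc]
  refine div_le_div_of_nonneg_right ?_ (by positivity)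
  have hone := (one_le_div hpos).2 hlow
  rw [add_mul, one_mul, one_div_mul_eq_div]
  linarith

/-- Finer differential privacy of the coordinate-wise independent compressor `M_{B,β}` on
`ℝ^d`: writing `q(g, s) = (B + β + s·clip(g,B))/(2B + 2β)`, for all `g, g' ∈ ℝ^d` with
`‖g − g'‖₁ ≤ 1` and all sign vectors `s ∈ {−1,1}^d`,
`∏ i, q(g'_i, s_i) ≤ (∏ i, (1 + 1/(β + dist(g_i, C_B)))) · ∏ i, q(g_i, s_i)`,
where `dist(g_i, C_B) = max(B − |g_i|, 0)`. -/
theorem compressor_vector_dp_fine (B β : ℝ) (hB : 0 < B) (hβ : 0 < β) (d : ℕ) (hd : 1 ≤ d)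
    (g g' s : Fin d → ℝ) (hdist : ∑ i, |g i - g' i| ≤ 1)
    (hs : ∀ i, s i = -1 ∨ s i = 1) :
    ∏ i, (B + β + s i * max (-B) (min B (g' i))) / (2 * B + 2 * β) ≤
      (∏ i, (1 + 1 / (β + max (B - |g i|) 0))) *
        ∏ i, (B + β + s i * max (-B) (min B (g i))) / (2 * B + 2 * β) := by
  rw [← Finset.prod_mul_distrib]
  refine Finset.prod_le_prod (fun i _ => ?_) fun i _ => ?_
  · have h := add_max_sub_abs_le_compressor hB β (g' i) (hs i)
    have h₀ := le_max_right (B - |g' i|) 0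
    exact div_nonneg (by linarith) (by positivity)
  · refine compressor_dp_fine hB hβ (le_trans ?_ hdist) (hs i)
    exact Finset.single_le_sum (f := fun i => |g i - g' i|) (fun j _ => abs_nonneg _)
      (Finset.mem_univ i)
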